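/- Feasibility of the Randomized Candidate Filtering mechanism: let v_1,…,v_n be d-self-bounding valuation functions and s a signal profile with v_i(s) > 0 for all i and low_j^i := inf_{o_i ∈ S_i} v_j(o_i, s_{-i}) > 0 for all i, j. Then the expected number of candidates satisfies ∑_{i=1}^n E_{r,π}[c_i] ≤ 2(d+1); consequently the allocation probabilities x_i := E_{r,π}[c_i] / (2(d+1)) satisfy ∑_{i=1}^n x_i ≤ 1. -/

import Mathlib

open MeasureTheory Finset

/-- Lower estimate of valuation `v` with respect to bidder `i` at profile `s`:
`low_i(v,s) = inf_{o_i ∈ S_i} v(o_i, s_{-i})`. -/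
noncomputable def lowEst {n : ℕ} {S : Fin n → Type*} [∀ i, Nonempty (S i)]
    (v : ((i : Fin n) → S i) → ℝ) (s : (i : Fin n) → S i) (i : Fin n) : ℝ :=
  sInf (Set.range fun o : S i => v (Function.update s i o))

/-- Truncated base-2 logarithm: `log₂†(a) = max(0, min(1, log₂ a))`. -/
noncomputable def logdag (a : ℝ) : ℝ := max 0 (min 1 (Real.logb 2 a))

/-- Random rounding-down function: `f_r(w) = 2^(r+k)` for the unique `k ∈ ℤ` with
`2^(r+k) ≤ w < 2^(r+k+1)`. -/
noncomputable def fr (r w : ℝ) : ℝ := (2 : ℝ) ^ (r + (⌊Real.logb 2 w - r⌋ : ℝ))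

/-- Lexicographic tie-breaking: `a >_π b`, where `a` is associated with bidder `i`
and `b` with bidder `j`, holds if `a > b`, or `a = b` and `π(i) > π(j)`. -/
def lexGt {n : ℕ} (π : Equiv.Perm (Fin n)) (i j : Fin n) (a b : ℝ) : Prop :=
  b < a ∨ (a = b ∧ π j < π i)

noncomputable instance {n : ℕ} (π : Equiv.Perm (Fin n)) (i j : Fin n) (a b : ℝ) :
    Decidable (lexGt π i j a b) := by unfold lexGt; infer_instance

/-- Bidder `i` is a candidate (for random seed `r` and tie-breaking permutation `π`)
if `f_r(v_i(s)) >_π f_r(low_j^i)` for every bidder `j ≠ i`. -/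
def IsCandidate {n : ℕ} {S : Fin n → Type*} [∀ i, Nonempty (S i)]
    (v : Fin n → ((i : Fin n) → S i) → ℝ) (s : (i : Fin n) → S i)
    (r : ℝ) (π : Equiv.Perm (Fin n)) (i : Fin n) : Prop :=
  ∀ j, j ≠ i → lexGt π i j (fr r (v i s)) (fr r (lowEst (v j) s i))

/-- `E_{r,π}[c_i]`: the probability that bidder `i` is a candidate, with `r`
uniform on `[0,1)` and `π` uniform over all `n!` permutations. -/
noncomputable def Ecand {n : ℕ} {S : Fin n → Type*} [∀ i, Nonempty (S i)]
    (v : Fin n → ((i : Fin n) → S i) → ℝ) (s : (i : Fin n) → S i) (i : Fin n) : ℝ :=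
  (n.factorial : ℝ)⁻¹ * ∑ π : Equiv.Perm (Fin n),
    (volume {r ∈ Set.Ico (0:ℝ) 1 | IsCandidate v s r π i}).toReal
section Permutations

variable {n : ℕ}

/-- The permutations ranking `i` weakly above every member of `C`. -/
def topPerms (C : Finset (Fin n)) (i : Fin n) : Finset (Equiv.Perm (Fin n)) :=
  univ.filter fun π => ∀ j ∈ C, π j ≤ π i

theorem mem_topPerms {C : Finset (Fin n)} {i : Fin n} {π : Equiv.Perm (Fin n)} :
    π ∈ topPerms C i ↔ ∀ j ∈ C, π j ≤ π i := by
  simp [topPerms]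

theorem topPerms_anti {C D : Finset (Fin n)} (h : C ⊆ D) (i : Fin n) :
    topPerms D i ⊆ topPerms C i := fun _π hπ =>
  mem_topPerms.2 fun j hj => mem_topPerms.1 hπ j (h hj)

theorem card_topPerms_le_of_mem {C : Finset (Fin n)} {a b : Fin n} (ha : a ∈ C) (hb : b ∈ C) :
    (topPerms C a).card ≤ (topPerms C b).card := by
  refine Finset.card_le_card_of_injOn (fun π => π * Equiv.swap a b) ?_
    (fun _ _ _ _ h => mul_right_cancel h)
  intro π hπ
  rw [Finset.mem_coe, mem_topPerms] at hπ ⊢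
  intro j hj
  simp only [Equiv.Perm.mul_apply, Equiv.swap_apply_right]
  apply hπ
  rcases eq_or_ne j a with rfl | hja
  · simpa using hb
  rcases eq_or_ne j b with rfl | hjb
  · simpa using ha
  rwa [Equiv.swap_apply_of_ne_of_ne hja hjb]

theorem card_mul_card_topPerms {C : Finset (Fin n)} {i : Fin n} (hi : i ∈ C) :
    C.card * (topPerms C i).card = n.factorial := by
  have hsum : ∑ a ∈ C, (topPerms C a).card = C.card * (topPerms C i).card := by
    rw [Finset.sum_const_nat]
    exact fun a ha => le_antisymm (card_topPerms_le_of_mem ha hi) (card_topPerms_le_of_mem hi ha)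
  rw [← hsum, ← Finset.card_biUnion]
  · have : C.biUnion (topPerms C) = univ := by
      ext π
      simp only [Finset.mem_biUnion, Finset.mem_univ, iff_true, mem_topPerms]
      exact Finset.exists_max_image C π ⟨i, hi⟩
    rw [this, Finset.card_univ, Fintype.card_perm, Fintype.card_fin]
  · intro a ha b hb hab
    refine Finset.disjoint_left.2 fun π h₁ h₂ => ?_
    exact hab (π.injective (le_antisymm (mem_topPerms.1 h₂ a ha) (mem_topPerms.1 h₁ b hb)))

theorem topPerms_prob {C : Finset (Fin n)} {i : Fin n} (hi : i ∈ C) :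
    (n.factorial : ℝ)⁻¹ * (topPerms C i).card = (C.card : ℝ)⁻¹ := by
  have hC : (C.card : ℝ) ≠ 0 := by exact_mod_cast (Finset.card_pos.2 ⟨i, hi⟩).ne'
  have hn : (n.factorial : ℝ) ≠ 0 := by exact_mod_cast n.factorial_ne_zero
  have h : (C.card : ℝ) * (topPerms C i).card = n.factorial := by
    exact_mod_cast card_mul_card_topPerms hi
  field_simp
  linarith

theorem topPerms_insert_self (C : Finset (Fin n)) (i : Fin n) :
    topPerms (insert i C) i = topPerms C i := by
  ext π
  simp [mem_topPerms]

theorem topPerms_sdiff_prob {C : Finset (Fin n)} {i j : Fin n} (hi : i ∉ C) (hj : j ∉ C)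
    (hij : i ≠ j) :
    (n.factorial : ℝ)⁻¹ * ((topPerms C i) \ (topPerms (insert j C) i)).card =
      (((C.card : ℝ) + 1) * (C.card + 2))⁻¹ := by
  have hsub : topPerms (insert j C) i ⊆ topPerms C i := topPerms_anti (Finset.subset_insert _ _) i
  rw [Finset.card_sdiff_of_subset hsub, Nat.cast_sub (Finset.card_le_card hsub), mul_sub,
    ← topPerms_insert_self C, ← topPerms_insert_self (insert j C),
    topPerms_prob (Finset.mem_insert_self _ _), topPerms_prob (Finset.mem_insert_self _ _),
    Finset.card_insert_of_notMem hi, Finset.card_insert_of_notMem (by simp [hij, hi]),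
    Finset.card_insert_of_notMem hj]
  push_cast
  field_simp
  ring

/-- The permutations for which `j` is the first index ranked strictly above `i`. -/
def firstAbove (i j : Fin n) : Finset (Equiv.Perm (Fin n)) :=
  topPerms (Iio j) i \ topPerms (insert j (Iio j)) i

theorem mem_firstAbove {i j : Fin n} {π : Equiv.Perm (Fin n)} :
    π ∈ firstAbove i j ↔ π i < π j ∧ ∀ k < j, π k ≤ π i := by
  simp only [firstAbove, Finset.mem_sdiff, mem_topPerms, Finset.mem_insert, Finset.mem_Iio,
    forall_eq_or_imp, not_and]
  constructor
  · rintro ⟨h₁, h₂⟩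
    exact ⟨not_le.1 fun h => h₂ h h₁, h₁⟩
  · rintro ⟨h₁, h₂⟩
    exact ⟨h₂, fun h => absurd h₁ (not_lt.2 h)⟩

theorem exists_mem_firstAbove {i j : Fin n} {π : Equiv.Perm (Fin n)} (h : π i < π j) :
    ∃ k ≤ j, π ∈ firstAbove i k := by
  obtain ⟨k, hk, hmin⟩ := Finset.exists_min_image (univ.filter fun k => π i < π k) id
    ⟨j, by simpa using h⟩
  simp only [Finset.mem_filter, Finset.mem_univ, true_and, id] at hk hmin
  exact ⟨k, hmin j h, mem_firstAbove.2 ⟨hk, fun l hl => not_lt.1 fun h' => absurd (hmin l h')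
    (not_le.2 hl)⟩⟩

theorem firstAbove_prob_of_lt {i j : Fin n} (h : j < i) :
    (n.factorial : ℝ)⁻¹ * (firstAbove i j).card = (((j : ℝ) + 1) * (j + 2))⁻¹ := by
  rw [firstAbove, topPerms_sdiff_prob (by simpa using h.le) (by simp) h.ne', Fin.card_Iio]

theorem firstAbove_prob_of_gt {i j : Fin n} (h : i < j) :
    (n.factorial : ℝ)⁻¹ * (firstAbove i j).card = ((j : ℝ) * (j + 1))⁻¹ := by
  have hi : i ∈ Iio j := by simpa using h
  have hC : topPerms (Iio j) i = topPerms ((Iio j).erase i) i := by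
    rw [← topPerms_insert_self ((Iio j).erase i), Finset.insert_erase hi]
  have hC' : topPerms (insert j (Iio j)) i = topPerms (insert j ((Iio j).erase i)) i := by
    rw [← topPerms_insert_self (insert j ((Iio j).erase i)), Finset.insert_comm,
      Finset.insert_erase hi]
  rw [firstAbove, hC, hC', topPerms_sdiff_prob (by simp) (by simp) h.ne,
    Finset.card_erase_of_mem hi, Fin.card_Iio]
  have hj : 1 ≤ (j : ℕ) := Nat.one_le_iff_ne_zero.2 (Nat.ne_of_gt (lt_of_le_of_lt (Nat.zero_le _) h))
  push_cast [Nat.cast_sub hj]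
  ring_nf

theorem firstAbove_prob_le {i j : Fin n} (h : j ≠ i) :
    (n.factorial : ℝ)⁻¹ * (firstAbove i j).card ≤
      (((j : ℝ) + 1) * (j + 2))⁻¹ + if i < j then 2 * ((j : ℝ) * (j + 1) * (j + 2))⁻¹ else 0 := by
  rcases lt_or_gt_of_ne h with h | h
  · rw [firstAbove_prob_of_lt h, if_neg (not_lt.2 h.le), add_zero]
  · rw [firstAbove_prob_of_gt h, if_pos h]
    have hj : (0 : ℝ) < j := by exact_mod_cast lt_of_le_of_lt (Nat.zero_le _) h
    apply le_of_eq
    field_simp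

theorem topPerms_initial_prob_le {q : ℕ} (hq : 0 < q) (hqn : q ≤ n) (i : Fin n) :
    (n.factorial : ℝ)⁻¹ * (topPerms (univ.filter fun j : Fin n => (j : ℕ) < q) i).card ≤
      ((q : ℝ) + 1)⁻¹ + if (i : ℕ) < q then ((q : ℝ) * (q + 1))⁻¹ else 0 := by
  have hcard : (univ.filter fun j : Fin n => (j : ℕ) < q).card = q := by
    rw [Fin.card_filter_val_lt, min_eq_right hqn]
  have hq' : (0 : ℝ) < q := by exact_mod_cast hq
  split_ifs with h
  · rw [topPerms_prob (by simpa using h), hcard]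
    apply le_of_eq
    field_simp
  · rw [← topPerms_insert_self, topPerms_prob (Finset.mem_insert_self _ _),
      Finset.card_insert_of_notMem (by simpa using h), hcard]
    simp

end Permutations

section Rounding

theorem fr_lt_fr_iff {r a b : ℝ} :
    fr r a < fr r b ↔ ⌊Real.logb 2 a - r⌋ < ⌊Real.logb 2 b - r⌋ := by
  unfold fr
  rw [Real.rpow_lt_rpow_left_iff one_lt_two, add_lt_add_iff_left, Int.cast_lt]

theorem fr_eq_fr_iff {r a b : ℝ} :
    fr r a = fr r b ↔ ⌊Real.logb 2 a - r⌋ = ⌊Real.logb 2 b - r⌋ := by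
  rw [le_antisymm_iff, le_antisymm_iff, ← not_lt, ← not_lt, ← not_lt, ← not_lt, fr_lt_fr_iff,
    fr_lt_fr_iff]

/-- The seeds for which rounding separates `a` from `b`, on a logarithmic scale. -/
def sepSeeds (a b : ℝ) : Set ℝ := {r ∈ Set.Ico (0 : ℝ) 1 | ⌊a - r⌋ < ⌊b - r⌋}

theorem volume_real_sepSeeds_le_one (a b : ℝ) : volume.real (sepSeeds a b) ≤ 1 := by
  calc volume.real (sepSeeds a b) ≤ volume.real (Set.Ico (0 : ℝ) 1) :=
        measureReal_mono (fun r hr => hr.1) (by simp)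
    _ = 1 := by simp

theorem volume_real_sepSeeds_le_sub {a b : ℝ} (hab : a ≤ b) :
    volume.real (sepSeeds a b) ≤ b - a := by
  set k := ⌊b⌋ with hk
  have hk₁ : (k : ℝ) ≤ b := Int.floor_le b
  have hk₂ : b < k + 1 := Int.lt_floor_add_one b
  have hsub : sepSeeds a b ⊆ Set.Icc (max 0 (a - k)) (b - k) ∪ Set.Ico (a - k + 1) 1 := by
    rintro r ⟨⟨hr₀, hr₁⟩, hr⟩
    have h₁ : a - r < ⌊b - r⌋ := Int.floor_lt.1 hr
    have h₂ : (⌊b - r⌋ : ℝ) ≤ b - r := Int.floor_le _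
    by_cases h : ⌊b - r⌋ = k
    · rw [h] at h₁ h₂
      exact Or.inl ⟨max_le hr₀ (by linarith), by linarith⟩
    · have h₃ : ⌊b - r⌋ ≤ k := Int.floor_le_floor (by linarith)
      have h₄ : ⌊b - r⌋ ≤ k - 1 := by omega
      have h₅ : (⌊b - r⌋ : ℝ) ≤ k - 1 := by exact_mod_cast h₄
      exact Or.inr ⟨by linarith, hr₁⟩
  calc volume.real (sepSeeds a b)
      ≤ volume.real (Set.Icc (max 0 (a - k)) (b - k) ∪ Set.Ico (a - k + 1) 1) :=
        measureReal_mono hsub ((measure_union_lt_top (by simp) (by simp)).ne)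
    _ ≤ volume.real (Set.Icc (max 0 (a - k)) (b - k)) + volume.real (Set.Ico (a - k + 1) 1) :=
        measureReal_union_le _ _
    _ = (b - k - max 0 (a - k)) + max (1 - (a - k + 1)) 0 := by
        rw [Real.volume_real_Icc_of_le (max_le (by linarith) (by linarith)),
          Real.volume_real_Ico]
    _ = b - a := by
        rcases le_total 0 (a - k) with h | h
        · rw [max_eq_right h, max_eq_right (by linarith)]; ring
        · rw [max_eq_left h, max_eq_left (by linarith)]; ring

theorem volume_real_sepSeeds_logb_le {x y : ℝ} (hx : 0 < x) (hxy : x ≤ y) :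
    volume.real (sepSeeds (Real.logb 2 x) (Real.logb 2 y)) ≤ 2 * ((y - x) / y) := by
  have hy : 0 < y := hx.trans_le hxy
  rcases le_total (2 * x) y with h | h
  · refine (volume_real_sepSeeds_le_one _ _).trans ?_
    rw [← mul_div_assoc, le_div_iff₀ hy]
    linarith
  · refine (volume_real_sepSeeds_le_sub (Real.logb_le_logb_of_le one_lt_two hx hxy)).trans ?_
    have hl : 0 < Real.log 2 := Real.log_pos one_lt_two
    have hc := strictConcaveOn_log_Ioi.concaveOn.2
      (show y ∈ Set.Ioi 0 from hy) (show y / 2 ∈ Set.Ioi 0 from half_pos hy)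
      (show 0 ≤ 1 - 2 * ((y - x) / y) by
        rw [sub_nonneg, ← mul_div_assoc, div_le_one hy]; linarith)
      (show 0 ≤ 2 * ((y - x) / y) from
        mul_nonneg zero_le_two (div_nonneg (sub_nonneg.2 hxy) hy.le)) (by ring)
    simp only [smul_eq_mul] at hc
    rw [show (1 - 2 * ((y - x) / y)) * y + 2 * ((y - x) / y) * (y / 2) = x by field_simp; ring,
      Real.log_div hy.ne' two_ne_zero] at hc
    rw [Real.logb, Real.logb, ← sub_div, div_le_iff₀ hl]
    nlinarith

end Rounding

section Counting

variable {n : ℕ}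

/-- The seeds for which `i` is `π`-maximal among the bidders rounded to the level of bidder `0`. -/
def topSeeds [NeZero n] (l : Fin n → ℝ) (π : Equiv.Perm (Fin n)) (i : Fin n) : Set ℝ :=
  {r ∈ Set.Ico (0 : ℝ) 1 | ⌊l i - r⌋ = ⌊l 0 - r⌋ ∧ ∀ j, ⌊l j - r⌋ = ⌊l 0 - r⌋ → π j ≤ π i}

theorem measurableSet_topSeeds [NeZero n] (l : Fin n → ℝ) (π : Equiv.Perm (Fin n)) (i : Fin n) :
    MeasurableSet (topSeeds l π i) := by
  have hm : ∀ j, MeasurableSet {r : ℝ | ⌊l j - r⌋ = ⌊l 0 - r⌋} := fun j =>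
    measurableSet_eq_fun (by fun_prop) (by fun_prop)
  have h_eq : {r : ℝ | ∀ j, ⌊l j - r⌋ = ⌊l 0 - r⌋ → π j ≤ π i} =
      ⋂ j, {r : ℝ | ⌊l j - r⌋ = ⌊l 0 - r⌋}ᶜ ∪ {_r : ℝ | π j ≤ π i} := by
    ext r
    simp [imp_iff_not_or]
  refine measurableSet_Ico.inter ((hm i).inter (?_ : MeasurableSet {r : ℝ | ∀ j, _}))
  rw [h_eq]
  exact MeasurableSet.iInter fun j => (hm j).compl.union (MeasurableSet.const _)

theorem sum_volume_real_topSeeds_le_one [NeZero n] (l : Fin n → ℝ) (π : Equiv.Perm (Fin n)) :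
    ∑ i, volume.real (topSeeds l π i) ≤ 1 := by
  have hfin : ∀ i, volume (topSeeds l π i) ≠ ⊤ := fun i =>
    measure_ne_top_of_subset (s := Set.Ico (0 : ℝ) 1) (fun r hr => hr.1)
      measure_Ico_lt_top.ne
  have hdisj : Set.PairwiseDisjoint (↑(univ : Finset (Fin n))) (topSeeds l π) := by
    intro i _ j _ hij
    refine Set.disjoint_left.2 fun r hi hj => hij (π.injective (le_antisymm ?_ ?_))
    · exact hj.2.2 i hi.2.1
    · exact hi.2.2 j hj.2.1
  rw [← measureReal_biUnion_finset hdisj (fun i _ => measurableSet_topSeeds l π i)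
    (fun i _ => hfin i)]
  calc _ ≤ volume.real (Set.Ico (0 : ℝ) 1) :=
        measureReal_mono (Set.iUnion₂_subset fun i _ r hr => hr.1) (by simp)
    _ = 1 := by simp

theorem exists_initial_of_antitone {l : Fin n → ℝ} (hl : Antitone l) (c : ℝ) :
    ∃ q ≤ n, ∀ j : Fin n, (j : ℕ) < q ↔ c < l j := by
  by_cases h : ∃ k, ∃ hk : k < n, l ⟨k, hk⟩ ≤ c
  · classical
    obtain ⟨hk, hle⟩ := Nat.find_spec h
    refine ⟨Nat.find h, hk.le, fun j => ⟨fun hj => ?_, fun hj => ?_⟩⟩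
    · by_contra hc
      exact Nat.find_min h hj ⟨j.2, not_lt.1 hc⟩
    · by_contra hc
      exact absurd ((hl (show ⟨_, hk⟩ ≤ j from not_lt.1 hc)).trans hle) (not_le.2 hj)
  · push Not at h
    exact ⟨n, le_rfl, fun j => ⟨fun _ => h j j.2, fun _ => j.2⟩⟩

/-- The seeds for which `i` is a candidate, given logarithms `l` of the values and `w` of the
lower estimates. -/
def candSeeds (l : Fin n → ℝ) (w : Fin n → Fin n → ℝ) (π : Equiv.Perm (Fin n)) (i : Fin n) :
    Set ℝ :=
  {r ∈ Set.Ico (0 : ℝ) 1 | ∀ j, j ≠ i →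
    ⌊w j i - r⌋ < ⌊l i - r⌋ ∨ (⌊l i - r⌋ = ⌊w j i - r⌋ ∧ π j < π i)}

theorem mem_of_mem_candSeeds [NeZero n] {l : Fin n → ℝ} {w : Fin n → Fin n → ℝ}
    (hl : Antitone l) {q : ℕ} (hq : ∀ j : Fin n, (j : ℕ) < q ↔ l 0 - 1 < l j)
    {π : Equiv.Perm (Fin n)} {i : Fin n} {r : ℝ} (hr : r ∈ candSeeds l w π i) :
    r ∈ topSeeds l π i ∨
    (i ≠ 0 ∧ π ∈ topPerms (univ.filter fun j : Fin n => (j : ℕ) < q) i ∧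
      r ∈ sepSeeds (w 0 i) (l 0)) ∨
    ∃ j : Fin n, (j : ℕ) < q ∧ j ≠ i ∧ π ∈ firstAbove i j ∧ r ∈ sepSeeds (w j i) (l j) := by
  obtain ⟨hr₀, hc⟩ := hr
  have hlow : ∀ j, π i < π j → ⌊w j i - r⌋ < ⌊l i - r⌋ := fun j hj =>
    (hc j (fun h => hj.ne (h ▸ rfl))).resolve_right fun h => absurd h.2 (not_lt.2 hj.le)
  have hne : ∀ j, π ∈ firstAbove i j → j ≠ i := fun j hj h =>
    (mem_firstAbove.1 hj).1.ne (h ▸ rfl)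
  have hF : ∀ {j k}, j ≤ k → ⌊l k - r⌋ ≤ ⌊l j - r⌋ := fun h =>
    Int.floor_le_floor (sub_le_sub_right (hl h) r)
  rcases (hF (Fin.zero_le i)).eq_or_lt with hi | hi
  · by_cases htop : ∀ j, ⌊l j - r⌋ = ⌊l 0 - r⌋ → π j ≤ π i
    · exact Or.inl ⟨hr₀, hi, htop⟩
    · push Not at htop
      obtain ⟨k, hk, hπ⟩ := htop
      obtain ⟨j, hjk, hj⟩ := exists_mem_firstAbove hπ
      have hj₀ : ⌊l j - r⌋ = ⌊l 0 - r⌋ := le_antisymm (hF (Fin.zero_le j)) (hk ▸ hF hjk)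
      refine Or.inr (Or.inr ⟨j, ?_, hne j hj, hj, hr₀, ?_⟩)
      · rw [hq]
        linarith [(abs_lt.1 (Int.abs_sub_lt_one_of_floor_eq_floor hj₀)).1]
      · rw [hj₀, ← hi]
        exact hlow j (mem_firstAbove.1 hj).1
  · have hi₀ : i ≠ 0 := fun h => hi.ne (h ▸ rfl)
    by_cases htop : ∀ j : Fin n, (j : ℕ) < q → π j ≤ π i
    · refine Or.inr (Or.inl ⟨hi₀, mem_topPerms.2 (by simpa using htop), hr₀, lt_of_le_of_lt ?_ hi⟩)
      rcases hc 0 hi₀.symm with h | h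
      · exact h.le
      · exact h.1.ge
    · push Not at htop
      obtain ⟨k, hk, hπ⟩ := htop
      obtain ⟨j, hjk, hj⟩ := exists_mem_firstAbove hπ
      have hjq : (j : ℕ) < q := lt_of_le_of_lt hjk hk
      refine Or.inr (Or.inr ⟨j, hjq, hne j hj, hj, hr₀, ?_⟩)
      have hlj := (hq j).1 hjq
      have h₁ : ⌊l 0 - r⌋ - 1 ≤ ⌊l j - r⌋ := by
        rw [← Int.floor_sub_one]
        exact Int.floor_le_floor (by linarith)
      have h₂ := hlow j (mem_firstAbove.1 hj).1
      omega

theorem volume_real_candSeeds_le [NeZero n] {l : Fin n → ℝ} {w : Fin n → Fin n → ℝ}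
    (hl : Antitone l) {q : ℕ} (hq : ∀ j : Fin n, (j : ℕ) < q ↔ l 0 - 1 < l j)
    (π : Equiv.Perm (Fin n)) (i : Fin n) :
    volume.real (candSeeds l w π i) ≤ volume.real (topSeeds l π i) +
      (if i ≠ 0 then if π ∈ topPerms (univ.filter fun j : Fin n => (j : ℕ) < q) i then
        volume.real (sepSeeds (w 0 i) (l 0)) else 0 else 0) +
      ∑ j ∈ univ.filter (fun j : Fin n => (j : ℕ) < q ∧ j ≠ i),
        if π ∈ firstAbove i j then volume.real (sepSeeds (w j i) (l j)) else 0 := by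
  classical
  set B : Set ℝ := if i ≠ 0 then
    if π ∈ topPerms (univ.filter fun j : Fin n => (j : ℕ) < q) i then sepSeeds (w 0 i) (l 0)
    else ∅ else ∅ with hB
  set D : Fin n → Set ℝ := fun j => if π ∈ firstAbove i j then sepSeeds (w j i) (l j) else ∅
    with hD
  set J := univ.filter (fun j : Fin n => (j : ℕ) < q ∧ j ≠ i) with hJ
  have hsub : candSeeds l w π i ⊆ (topSeeds l π i ∪ B) ∪ ⋃ j ∈ J, D j := by
    intro r hr
    rcases mem_of_mem_candSeeds hl hq hr with h | ⟨h₁, h₂, h₃⟩ | ⟨j, h₁, h₂, h₃, h₄⟩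
    · exact Or.inl (Or.inl h)
    · refine Or.inl (Or.inr ?_)
      rwa [hB, if_pos h₁, if_pos h₂]
    · refine Or.inr (Set.mem_biUnion (x := j) (by simp [hJ, h₁, h₂]) ?_)
      simpa only [hD, if_pos h₃] using h₄
  have hsep : ∀ a b, sepSeeds a b ⊆ Set.Ico 0 1 := fun a b r hr => hr.1
  have hbd : (topSeeds l π i ∪ B) ∪ ⋃ j ∈ J, D j ⊆ Set.Ico (0 : ℝ) 1 := by
    refine Set.union_subset (Set.union_subset (fun r hr => hr.1) ?_) (Set.iUnion₂_subset ?_)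
    · rw [hB]
      split_ifs <;> simp [hsep]
    · intro j _
      simp only [hD]
      split_ifs <;> simp [hsep]
  have hBv : volume.real B = if i ≠ 0 then
      if π ∈ topPerms (univ.filter fun j : Fin n => (j : ℕ) < q) i then
        volume.real (sepSeeds (w 0 i) (l 0)) else 0 else 0 := by
    rw [hB]
    split_ifs <;> simp
  have hDv : ∀ j, volume.real (D j) =
      if π ∈ firstAbove i j then volume.real (sepSeeds (w j i) (l j)) else 0 := by
    intro j
    simp only [hD]
    split_ifs <;> simp
  rw [← hBv, ← Finset.sum_congr rfl fun j _ => hDv j]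
  calc volume.real (candSeeds l w π i)
      ≤ volume.real ((topSeeds l π i ∪ B) ∪ ⋃ j ∈ J, D j) :=
        measureReal_mono hsub (measure_ne_top_of_subset hbd (by simp))
    _ ≤ volume.real (topSeeds l π i ∪ B) + volume.real (⋃ j ∈ J, D j) := measureReal_union_le _ _
    _ ≤ _ := add_le_add (measureReal_union_le _ _) (measureReal_biUnion_finset_le _ _)

theorem sum_range_inv_mul_succ (q : ℕ) :
    ∑ j ∈ range q, (((j : ℝ) + 1) * (j + 2))⁻¹ = 1 - ((q : ℝ) + 1)⁻¹ := by
  induction q with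
  | zero => simp
  | succ q ih =>
    rw [Finset.sum_range_succ, ih]
    push_cast
    field_simp
    ring

theorem sum_range_mul_inv {q : ℕ} (hq : 0 < q) :
    ∑ j ∈ range q, (j : ℝ) * (2 * ((j : ℝ) * (j + 1) * (j + 2))⁻¹) = 1 - 2 * ((q : ℝ) + 1)⁻¹ := by
  induction q, hq using Nat.le_induction with
  | base => norm_num
  | succ q hq ih =>
    have : (0 : ℝ) < q := by exact_mod_cast hq
    rw [Finset.sum_range_succ, ih]
    push_cast
    field_simp
    ring

theorem sum_filter_val_lt {q : ℕ} (hqn : q ≤ n) (f : ℕ → ℝ) :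
    ∑ j ∈ univ.filter (fun j : Fin n => (j : ℕ) < q), f j = ∑ j ∈ range q, f j := by
  refine Finset.sum_bij (fun j _ => (j : ℕ)) (by simp) (fun a _ b _ h => Fin.ext h) ?_ (by simp)
  intro b hb
  have hb' := Finset.mem_range.1 hb
  exact ⟨⟨b, hb'.trans_le hqn⟩, by simpa using hb', rfl⟩

theorem sum_weights_le {D : ℝ} {y : Fin n → Fin n → ℝ} (hy₀ : ∀ j i, 0 ≤ y j i)
    (hy₁ : ∀ j i, y j i ≤ 1) (hsum : ∀ j, ∑ i, y j i ≤ D) {q : ℕ} (hq : 0 < q) (hqn : q ≤ n) :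
    ∑ i, ∑ j ∈ univ.filter (fun j : Fin n => (j : ℕ) < q ∧ j ≠ i),
      ((n.factorial : ℝ)⁻¹ * (firstAbove i j).card) * y j i ≤
      D * (1 - ((q : ℝ) + 1)⁻¹) + (1 - 2 * ((q : ℝ) + 1)⁻¹) := by
  set α : ℕ → ℝ := fun j => (((j : ℝ) + 1) * (j + 2))⁻¹ with hα
  set β : ℕ → ℝ := fun j => 2 * ((j : ℝ) * (j + 1) * (j + 2))⁻¹ with hβ
  have hα₀ : ∀ j, 0 ≤ α j := fun j => by positivity
  have hβ₀ : ∀ j, 0 ≤ β j := fun j => by positivity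
  calc _ ≤ ∑ i, ∑ j ∈ univ.filter (fun j : Fin n => (j : ℕ) < q),
        (α j * y j i + if i < j then β j else 0) := by
        refine Finset.sum_le_sum fun i _ => ?_
        have hnn : ∀ j : Fin n, 0 ≤ α j * y j i + if i < j then β j else 0 := fun j =>
          add_nonneg (mul_nonneg (hα₀ _) (hy₀ _ _)) (by split_ifs <;> simp [hβ₀])
        refine (Finset.sum_le_sum fun j hj => ?_).trans (Finset.sum_le_sum_of_subset_of_nonneg
          (fun j hj => ?_) (fun j _ _ => hnn j))
        · have hji := (Finset.mem_filter.1 hj).2.2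
          refine (mul_le_mul_of_nonneg_right (firstAbove_prob_le hji) (hy₀ _ _)).trans ?_
          rw [add_mul]
          gcongr
          split_ifs
          · exact mul_le_of_le_one_right (hβ₀ _) (hy₁ _ _)
          · simp
        · simp only [Finset.mem_filter, Finset.mem_univ, true_and] at hj ⊢
          exact hj.1
    _ = ∑ j ∈ univ.filter (fun j : Fin n => (j : ℕ) < q),
          (α j * ∑ i, y j i + (j : ℝ) * β j) := by
        rw [Finset.sum_comm]
        refine Finset.sum_congr rfl fun j _ => ?_
        rw [Finset.sum_add_distrib, ← Finset.mul_sum, ← Finset.sum_filter, Finset.sum_const,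
          nsmul_eq_mul]
        congr 3
        rw [← Fin.card_Iio j]
        congr 1
        ext i
        simp
    _ ≤ ∑ j ∈ univ.filter (fun j : Fin n => (j : ℕ) < q), (D * α j + (j : ℝ) * β j) := by
        refine Finset.sum_le_sum fun j _ => ?_
        rw [mul_comm D]
        gcongr
        exact hsum j
    _ = _ := by
        rw [sum_filter_val_lt hqn (fun j => D * α j + (j : ℝ) * β j), Finset.sum_add_distrib,
          ← Finset.mul_sum, sum_range_inv_mul_succ, sum_range_mul_inv hq]

theorem sum_initial_weights_le [NeZero n] {D : ℝ} {y : Fin n → ℝ} (hy₀ : ∀ i, 0 ≤ y i)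
    (hy₁ : ∀ i, y i ≤ 1) (hsum : ∑ i, y i ≤ D) {q : ℕ} (hq : 0 < q) (hqn : q ≤ n) :
    ∑ i : Fin n, (if i ≠ 0 then ((n.factorial : ℝ)⁻¹ *
      (topPerms (univ.filter fun j : Fin n => (j : ℕ) < q) i).card) * y i else 0) ≤
      D * ((q : ℝ) + 1)⁻¹ + ((q : ℝ) + 1)⁻¹ := by
  have hq' : (0 : ℝ) < q := by exact_mod_cast hq
  calc _ ≤ ∑ i : Fin n, (y i * ((q : ℝ) + 1)⁻¹ +
          if (i : ℕ) < q then ((q : ℝ) * (q + 1))⁻¹ else 0) := by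
        refine Finset.sum_le_sum fun i _ => ?_
        have h₀ : 0 ≤ if (i : ℕ) < q then ((q : ℝ) * (q + 1))⁻¹ else 0 := by
          split_ifs <;> positivity
        by_cases hi : i ≠ 0
        · rw [if_pos hi]
          refine (mul_le_mul_of_nonneg_right (topPerms_initial_prob_le hq hqn i) (hy₀ i)).trans ?_
          rw [add_mul, mul_comm]
          gcongr
          exact mul_le_of_le_one_right h₀ (hy₁ i)
        · rw [if_neg hi]
          have := hy₀ i
          positivity
    _ = (∑ i, y i) * ((q : ℝ) + 1)⁻¹ + ((q : ℝ) + 1)⁻¹ := by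
        rw [Finset.sum_add_distrib, ← Finset.sum_mul, ← Finset.sum_filter, Finset.sum_const,
          Fin.card_filter_val_lt, min_eq_right hqn, nsmul_eq_mul]
        congr 1
        field_simp
    _ ≤ _ := by gcongr

theorem inv_factorial_mul_sum_ite (P : Finset (Equiv.Perm (Fin n))) (c : ℝ) :
    (n.factorial : ℝ)⁻¹ * ∑ π : Equiv.Perm (Fin n), (if π ∈ P then c else 0) =
      ((n.factorial : ℝ)⁻¹ * P.card) * c := by
  rw [← Finset.sum_filter, Finset.sum_const, nsmul_eq_mul, Finset.filter_univ_mem, mul_assoc]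

theorem sum_candSeeds_le_of_antitone {D : ℝ} {l : Fin n → ℝ} {w : Fin n → Fin n → ℝ}
    (hD : 0 ≤ D) (hl : Antitone l) (hsum : ∀ j, ∑ i, volume.real (sepSeeds (w j i) (l j)) ≤ D) :
    ∑ i, (n.factorial : ℝ)⁻¹ * ∑ π : Equiv.Perm (Fin n), volume.real (candSeeds l w π i) ≤
      D + 2 := by
  rcases Nat.eq_zero_or_pos n with rfl | hn
  · simp only [Finset.univ_eq_empty, Finset.sum_empty]
    linarith
  have : NeZero n := ⟨hn.ne'⟩
  obtain ⟨q, hqn, hq⟩ := exists_initial_of_antitone hl (l 0 - 1)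
  have hq₀ : 0 < q := by
    have := (hq 0).2 (by linarith)
    omega
  have hfact : (0 : ℝ) < n.factorial := by exact_mod_cast n.factorial_pos
  set y : Fin n → Fin n → ℝ := fun j i => volume.real (sepSeeds (w j i) (l j)) with hy
  have hy₀ : ∀ j i, 0 ≤ y j i := fun j i => measureReal_nonneg
  have hy₁ : ∀ j i, y j i ≤ 1 := fun j i => volume_real_sepSeeds_le_one _ _
  have htop : ∑ i, (n.factorial : ℝ)⁻¹ *
      ∑ π : Equiv.Perm (Fin n), volume.real (topSeeds l π i) ≤ 1 := by
    rw [← Finset.mul_sum, Finset.sum_comm, inv_mul_le_iff₀ hfact, mul_one]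
    refine (Finset.sum_le_sum fun π _ => sum_volume_real_topSeeds_le_one l π).trans ?_
    simp [Fintype.card_perm]
  have hfirst := sum_weights_le hy₀ hy₁ hsum hq₀ hqn
  have hinit := sum_initial_weights_le (hy₀ 0) (hy₁ 0) (hsum 0) hq₀ hqn
  have hpt : ∀ i, (n.factorial : ℝ)⁻¹ *
      ∑ π : Equiv.Perm (Fin n), volume.real (candSeeds l w π i) ≤
      (n.factorial : ℝ)⁻¹ * ∑ π : Equiv.Perm (Fin n), volume.real (topSeeds l π i) +
      (if i ≠ 0 then ((n.factorial : ℝ)⁻¹ *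
        (topPerms (univ.filter fun j : Fin n => (j : ℕ) < q) i).card) * y 0 i else 0) +
      ∑ j ∈ univ.filter (fun j : Fin n => (j : ℕ) < q ∧ j ≠ i),
        ((n.factorial : ℝ)⁻¹ * (firstAbove i j).card) * y j i := by
    intro i
    refine (mul_le_mul_of_nonneg_left (Finset.sum_le_sum fun π _ =>
      volume_real_candSeeds_le hl hq π i) (inv_nonneg.2 hfact.le)).trans (le_of_eq ?_)
    rw [Finset.sum_add_distrib, Finset.sum_add_distrib, mul_add, mul_add,
      Finset.sum_comm]
    congr 1
    · congr 1
      split_ifs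
      · exact inv_factorial_mul_sum_ite _ _
      · simp
    · rw [Finset.mul_sum]
      exact Finset.sum_congr rfl fun j _ => inv_factorial_mul_sum_ite (firstAbove i j) (y j i)
  refine (Finset.sum_le_sum fun i _ => hpt i).trans ?_
  rw [Finset.sum_add_distrib, Finset.sum_add_distrib]
  have : 0 ≤ ((q : ℝ) + 1)⁻¹ := by positivity
  linarith

theorem candSeeds_comp (σ : Equiv.Perm (Fin n)) (l : Fin n → ℝ) (w : Fin n → Fin n → ℝ)
    (π : Equiv.Perm (Fin n)) (i : Fin n) :
    candSeeds (l ∘ σ) (fun j i => w (σ j) (σ i)) (π * σ) i = candSeeds l w π (σ i) := by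
  ext r
  simp only [candSeeds, Set.mem_ofPred_eq, Function.comp, Equiv.Perm.mul_apply]
  refine and_congr_right fun _ => ?_
  rw [← σ.forall_congr_right (q := fun j => j ≠ σ i →
    ⌊w j (σ i) - r⌋ < ⌊l (σ i) - r⌋ ∨ (⌊l (σ i) - r⌋ = ⌊w j (σ i) - r⌋ ∧ π j < π (σ i)))]
  simp only [ne_eq, σ.injective.eq_iff]

theorem sum_candSeeds_le {D : ℝ} {l : Fin n → ℝ} {w : Fin n → Fin n → ℝ}
    (hD : 0 ≤ D) (hsum : ∀ j, ∑ i, volume.real (sepSeeds (w j i) (l j)) ≤ D) :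
    ∑ i, (n.factorial : ℝ)⁻¹ * ∑ π : Equiv.Perm (Fin n), volume.real (candSeeds l w π i) ≤
      D + 2 := by
  set σ : Equiv.Perm (Fin n) := Tuple.sort fun i => -l i
  have hanti : Antitone (l ∘ σ) := fun i j hij =>
    neg_le_neg_iff.1 (Tuple.monotone_sort (fun i => -l i) hij)
  have h := sum_candSeeds_le_of_antitone (w := fun j i => w (σ j) (σ i)) hD hanti fun j => by
    rw [Equiv.sum_comp σ fun i => volume.real (sepSeeds (w (σ j) i) ((l ∘ σ) j))]
    exact hsum (σ j)
  rw [← Equiv.sum_comp σ]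
  refine le_trans (le_of_eq (Finset.sum_congr rfl fun i _ => ?_)) h
  rw [← Equiv.sum_comp (Equiv.mulRight σ) fun π =>
    volume.real (candSeeds (l ∘ σ) (fun j i => w (σ j) (σ i)) π i)]
  simp only [Equiv.coe_mulRight, candSeeds_comp]

end Counting

section Mechanism

variable {n : ℕ} {S : Fin n → Type*} [∀ i, Nonempty (S i)]

theorem lowEst_le {v : ((i : Fin n) → S i) → ℝ} (hv : ∀ s, 0 ≤ v s) (s : (i : Fin n) → S i)
    (i : Fin n) : lowEst v s i ≤ v s := by
  refine csInf_le ⟨0, ?_⟩ ⟨s i, by simp⟩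
  rintro _ ⟨o, rfl⟩
  exact hv _

theorem Ecand_eq_candSeeds (v : Fin n → ((i : Fin n) → S i) → ℝ) (s : (i : Fin n) → S i)
    (i : Fin n) :
    Ecand v s i = (n.factorial : ℝ)⁻¹ * ∑ π : Equiv.Perm (Fin n),
      volume.real (candSeeds (fun j => Real.logb 2 (v j s))
        (fun j k => Real.logb 2 (lowEst (v j) s k)) π i) := by
  simp only [Ecand, IsCandidate, lexGt, fr_lt_fr_iff, fr_eq_fr_iff, candSeeds, measureReal_def]

end Mechanism

/-- Feasibility of the Randomized Candidate Filtering mechanism: for d-self-bounding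
valuations, the expected number of candidates is at most `2(d+1)`, hence the
allocation probabilities `x_i = E[c_i]/(2(d+1))` sum to at most 1. -/
theorem rcf_feasibility {n : ℕ} {S : Fin n → Type*} [∀ i, Nonempty (S i)]
    (d : ℕ) (v : Fin n → ((i : Fin n) → S i) → ℝ)
    (hnonneg : ∀ j s, 0 ≤ v j s)
    (hsb : ∀ (j : Fin n) (s : (i : Fin n) → S i),
      ∑ i : Fin n, (v j s - lowEst (v j) s i) ≤ (d : ℝ) * v j s)
    (s : (i : Fin n) → S i)
    (hpos : ∀ i, 0 < v i s)
    (hlowpos : ∀ j i, 0 < lowEst (v j) s i) :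
    (∑ i : Fin n, Ecand v s i ≤ 2 * ((d : ℝ) + 1)) ∧
    (∑ i : Fin n, Ecand v s i / (2 * ((d : ℝ) + 1)) ≤ 1) := by
  have hsum : ∑ i : Fin n, Ecand v s i ≤ 2 * ((d : ℝ) + 1) := by
    have hD : (0 : ℝ) ≤ 2 * d := by positivity
    simp only [Ecand_eq_candSeeds]
    refine (sum_candSeeds_le hD fun j => ?_).trans (by linarith)
    calc _ ≤ ∑ i, 2 * ((v j s - lowEst (v j) s i) / v j s) := Finset.sum_le_sum fun i _ =>
          volume_real_sepSeeds_logb_le (hlowpos j i) (lowEst_le (hnonneg j) s i)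
      _ = 2 * ((∑ i, (v j s - lowEst (v j) s i)) / v j s) := by
          rw [← Finset.mul_sum, Finset.sum_div]
      _ ≤ 2 * d := by
          gcongr
          exact (div_le_iff₀ (hpos j)).2 (hsb j s)
  refine ⟨hsum, ?_⟩
  rw [← Finset.sum_div, div_le_one (by positivity)]
  exact hsum
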